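/- Let ε > 0 and let u : ℝ³ → ℝ be a continuous radial function (u(x) depends only on |x|) with |u(x)| ≤ C(1+|x|) for some C > 0, satisfying the regularized integral equation u(x) = −(1/(8π)) ∫_{ℝ³} |x−y| e^{−ε|y|²} e^{u(y)} dy for all x ∈ ℝ³. Let U : [0,∞) → ℝ be the radial profile of u, i.e. u(x) = U(|x|). Then U is differentiable on (0,∞) with U'(r) < 0 for every r > 0; in particular U is strictly decreasing. -/

import Mathlib

open MeasureTheory

section GaussianIntegrability

variable {V : Type*} [NormedAddCommGroup V] [InnerProductSpace ℝ V] [FiniteDimensional ℝ V]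
  [MeasurableSpace V] [BorelSpace V]

theorem integrable_exp_neg_mul_norm_sq {b : ℝ} (hb : 0 < b) :
    Integrable fun y : V => Real.exp (-b * ‖y‖ ^ 2) := by
  have h := (GaussianFourier.integrable_cexp_neg_mul_sq_norm_add
    (show 0 < (b : ℂ).re from hb) 0 (0 : V)).norm
  refine h.congr (Filter.Eventually.of_forall fun y => ?_)
  simp only [Complex.norm_exp, zero_mul, add_zero]
  congr 1
  norm_cast

theorem integrable_exp_mul_norm_sub_mul_norm_sq (a : ℝ) {b : ℝ} (hb : 0 < b) :
    Integrable fun y : V => Real.exp (a * ‖y‖ - b * ‖y‖ ^ 2) := by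
  refine ((integrable_exp_neg_mul_norm_sq (V := V) (half_pos hb)).const_mul
    (Real.exp (a ^ 2 / (2 * b)))).mono' (by fun_prop) (Filter.Eventually.of_forall fun y => ?_)
  rw [Real.norm_eq_abs, Real.abs_exp, ← Real.exp_add, Real.exp_le_exp]
  have h : a ^ 2 / (2 * b) + -(b / 2) * ‖y‖ ^ 2 - (a * ‖y‖ - b * ‖y‖ ^ 2)
      = (b / 2) * (‖y‖ - a / b) ^ 2 := by
    field_simp
    ring
  nlinarith [mul_nonneg (half_pos hb).le (sq_nonneg (‖y‖ - a / b))]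

/-- A Gaussian times the exponential of a function of linear growth has a finite integral and a
finite first moment. -/
theorem integrable_gaussian_mul_exp {u : V → ℝ} (hu : Continuous u) {C b : ℝ} (hb : 0 < b)
    (hgrowth : ∀ x, |u x| ≤ C * (1 + ‖x‖)) :
    Integrable (fun y => Real.exp (-b * ‖y‖ ^ 2) * Real.exp (u y)) ∧
      Integrable (fun y => ‖y‖ * (Real.exp (-b * ‖y‖ ^ 2) * Real.exp (u y))) := by
  have key (y : V) : Real.exp (-b * ‖y‖ ^ 2) * Real.exp (u y)
      ≤ Real.exp C * Real.exp (C * ‖y‖ - b * ‖y‖ ^ 2) := by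
    rw [← Real.exp_add, ← Real.exp_add, Real.exp_le_exp]
    linarith [(abs_le.1 (hgrowth y)).2]
  constructor
  · refine ((integrable_exp_mul_norm_sub_mul_norm_sq (V := V) C hb).const_mul
      (Real.exp C)).mono' (by fun_prop) (Filter.Eventually.of_forall fun y => ?_)
    rw [Real.norm_of_nonneg (by positivity)]
    exact key y
  · refine ((integrable_exp_mul_norm_sub_mul_norm_sq (V := V) (C + 1) hb).const_mul
      (Real.exp C)).mono' (by fun_prop) (Filter.Eventually.of_forall fun y => ?_)
    rw [Real.norm_of_nonneg (by positivity)]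
    calc ‖y‖ * (Real.exp (-b * ‖y‖ ^ 2) * Real.exp (u y))
        ≤ Real.exp ‖y‖ * (Real.exp C * Real.exp (C * ‖y‖ - b * ‖y‖ ^ 2)) := by
          refine mul_le_mul ?_ (key y) (by positivity) (by positivity)
          linarith [Real.add_one_le_exp ‖y‖]
      _ = Real.exp C * Real.exp ((C + 1) * ‖y‖ - b * ‖y‖ ^ 2) := by
          rw [mul_left_comm, ← Real.exp_add]
          ring_nf

end GaussianIntegrability

section NormPotential

variable {V : Type*} [NormedAddCommGroup V] [InnerProductSpace ℝ V] [FiniteDimensional ℝ V]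
  [MeasurableSpace V] [BorelSpace V] {μ : Measure V} {w : V → ℝ}

theorem integrable_norm_sub_mul (hw : Continuous w) (hw0 : ∀ y, 0 ≤ w y) (hi : Integrable w μ)
    (hi' : Integrable (fun y => ‖y‖ * w y) μ) (x : V) :
    Integrable (fun y => ‖x - y‖ * w y) μ := by
  refine ((hi.const_mul ‖x‖).add hi').mono' (by fun_prop) (Filter.Eventually.of_forall fun y => ?_)
  rw [Real.norm_of_nonneg (mul_nonneg (norm_nonneg _) (hw0 y)), Pi.add_apply, ← add_mul]
  exact mul_le_mul_of_nonneg_right (norm_sub_le x y) (hw0 y)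

theorem convexOn_integral_norm_sub_mul (hw : Continuous w) (hw0 : ∀ y, 0 ≤ w y)
    (hi : Integrable w μ) (hi' : Integrable (fun y => ‖y‖ * w y) μ) :
    ConvexOn ℝ Set.univ fun x => ∫ y, ‖x - y‖ * w y ∂μ := by
  have hint := integrable_norm_sub_mul hw hw0 hi hi'
  refine ⟨convex_univ, fun x _ z _ a b ha hb hab => ?_⟩
  simp only [smul_eq_mul]
  rw [← integral_const_mul, ← integral_const_mul,
    ← integral_add ((hint x).const_mul a) ((hint z).const_mul b)]
  refine integral_mono (hint _) (((hint x).const_mul a).add ((hint z).const_mul b)) fun y => ?_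
  have h := (convexOn_univ_dist y).2 (Set.mem_univ x) (Set.mem_univ z) ha hb hab
  simp only [dist_eq_norm, smul_eq_mul] at h
  calc _ ≤ (a * ‖x - y‖ + b * ‖z - y‖) * w y := mul_le_mul_of_nonneg_right h (hw0 y)
    _ = _ := by ring

theorem differentiableAt_integral_norm_smul_sub_mul [NullSingletonClass μ] (hw : Continuous w)
    (hw0 : ∀ y, 0 ≤ w y) (hi : Integrable w μ) (hi' : Integrable (fun y => ‖y‖ * w y) μ)
    {e : V} (he : ‖e‖ = 1) (r : ℝ) :
    DifferentiableAt ℝ (fun t : ℝ => ∫ y, ‖t • e - y‖ * w y ∂μ) r := by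
  have hint := integrable_norm_sub_mul hw hw0 hi hi'
  have hcont : Continuous (Function.uncurry fun (y : V) (t : ℝ) => ‖t • e - y‖ * w y) := by
    fun_prop
  refine (hasDerivAt_integral_of_dominated_loc_of_lip
    (F' := fun y => deriv (fun t : ℝ => ‖t • e - y‖ * w y) r) (bound := w) Filter.univ_mem
    (Filter.Eventually.of_forall fun t => (hint _).aestronglyMeasurable) (hint _)
    ?_ (Filter.Eventually.of_forall fun y => ?_) hi ?_).2.differentiableAt
  · exact ((stronglyMeasurable_deriv_with_param hcont).comp_measurable
      (measurable_id.prodMk measurable_const)).aestronglyMeasurable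
  · refine LipschitzOnWith.of_dist_le_mul fun s _ t _ => ?_
    rw [Real.coe_nnabs, Real.dist_eq, Real.dist_eq, ← sub_mul, abs_mul, mul_comm]
    refine mul_le_mul_of_nonneg_left ((abs_norm_sub_norm_le _ _).trans ?_) (abs_nonneg _)
    rw [sub_sub_sub_cancel_right, ← sub_smul, norm_smul, he, mul_one, Real.norm_eq_abs]
  · filter_upwards [Measure.ae_ne μ (r • e)] with y hy
    refine DifferentiableAt.hasDerivAt (DifferentiableAt.mul_const ?_ _)
    exact DifferentiableAt.norm ℝ (by fun_prop) (sub_ne_zero.2 hy.symm)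

/-- Averaged over `x` and `-x`, the potential of a positive density is larger than at the origin. -/
theorem two_mul_integral_norm_mul_lt [μ.IsOpenPosMeasure] (hw : Continuous w) (hw0 : ∀ y, 0 < w y)
    (hi : Integrable w μ) (hi' : Integrable (fun y => ‖y‖ * w y) μ) {x : V} (hx : x ≠ 0) :
    2 * ∫ y, ‖0 - y‖ * w y ∂μ < (∫ y, ‖x - y‖ * w y ∂μ) + ∫ y, ‖-x - y‖ * w y ∂μ := by
  have hint := integrable_norm_sub_mul hw (fun y => (hw0 y).le) hi hi'
  have hsum : Integrable (fun y => ‖x - y‖ * w y + ‖-x - y‖ * w y) μ :=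
    (hint x).add (hint (-x))
  rw [← sub_pos, ← integral_const_mul, ← integral_add (hint x) (hint (-x)),
    ← integral_sub hsum ((hint 0).const_mul 2)]
  refine integral_pos_of_integrable_nonneg_nonzero (x := 0) (by fun_prop)
    (hsum.sub ((hint 0).const_mul 2)) (fun y => ?_) ?_
  · have h : 2 * ‖0 - y‖ ≤ ‖x - y‖ + ‖-x - y‖ := by
      calc 2 * ‖0 - y‖ = ‖(2 : ℝ) • (0 - y)‖ := by simp [norm_smul]
        _ = ‖(x - y) + (-x - y)‖ := by
          congr 1
          module
        _ ≤ _ := norm_add_le _ _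
    simp only [Pi.zero_apply]
    nlinarith [hw0 y]
  · have h0 := hw0 0
    have h1 := norm_pos_iff.2 hx
    simp only [sub_zero, norm_neg, norm_zero, zero_mul, mul_zero]
    positivity

end NormPotential

/-- Monotonicity of solutions of the regularized 3D Liouville integral equation: if `u : ℝ³ → ℝ`
is continuous and radial with radial profile `U` (`u(x) = U(|x|)`), grows at most linearly, and
satisfies `u(x) = −(1/(8π)) ∫_{ℝ³} |x−y| e^{−ε|y|²} e^{u(y)} dy`, then `U` is differentiable on
`(0,∞)` with `U'(r) < 0` for every `r > 0`; in particular `U` is strictly decreasing there. -/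
theorem stmt13 (ε : ℝ) (hε : 0 < ε) (u : EuclideanSpace ℝ (Fin 3) → ℝ)
    (hu : Continuous u) (C : ℝ) (hC : 0 < C)
    (hgrowth : ∀ x : EuclideanSpace ℝ (Fin 3), |u x| ≤ C * (1 + ‖x‖))
    (heq : ∀ x : EuclideanSpace ℝ (Fin 3),
      u x = -(1 / (8 * Real.pi)) *
        ∫ y : EuclideanSpace ℝ (Fin 3), ‖x - y‖ * Real.exp (-ε * ‖y‖ ^ 2) * Real.exp (u y))
    (U : ℝ → ℝ) (hU : ∀ x : EuclideanSpace ℝ (Fin 3), u x = U ‖x‖) :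
    (∀ r : ℝ, 0 < r → DifferentiableAt ℝ U r ∧ deriv U r < 0) ∧
      StrictAntiOn U (Set.Ioi 0) := by
  obtain ⟨e, he⟩ := exists_norm_eq (EuclideanSpace ℝ (Fin 3)) zero_le_one
  set w : EuclideanSpace ℝ (Fin 3) → ℝ :=
    fun y => Real.exp (-ε * ‖y‖ ^ 2) * Real.exp (u y) with hw_def
  have hw : Continuous w := by fun_prop
  have hw0 (y) : 0 < w y := by positivity
  obtain ⟨hi, hi'⟩ : Integrable w ∧ Integrable fun y => ‖y‖ * w y :=
    integrable_gaussian_mul_exp hu hε hgrowth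
  set F : EuclideanSpace ℝ (Fin 3) → ℝ := fun x => ∫ y, ‖x - y‖ * w y with hF
  have hk : 0 < 1 / (8 * Real.pi) := by positivity
  have huF (x) : u x = -(1 / (8 * Real.pi)) * F x := by
    simp only [heq x, hF, hw_def, mul_assoc]
  have hneg (x) : F (-x) = F x := by
    refine mul_left_cancel₀ (neg_ne_zero.2 hk.ne') ?_
    rw [← huF, ← huF, hU, hU, norm_neg]
  have hconv : ConvexOn ℝ Set.univ fun t : ℝ => F (t • e) :=
    (convexOn_integral_norm_sub_mul hw (fun y => (hw0 y).le) hi hi').comp_linearMap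
      (LinearMap.toSpanSingleton ℝ _ e)
  have hderiv (r : ℝ) (hr : 0 < r) : ∃ d, 0 < d ∧
      HasDerivAt U (-(1 / (8 * Real.pi)) * d) r := by
    have hd := differentiableAt_integral_norm_smul_sub_mul hw (fun y => (hw0 y).le) hi hi' he r
    refine ⟨deriv (fun t : ℝ => F (t • e)) r, ?_, ?_⟩
    · refine lt_of_lt_of_le ?_
        (hconv.slope_le_deriv (Set.mem_univ 0) (Set.mem_univ r) hr hd)
      rw [slope_def_field, zero_smul, sub_zero]
      have he0 : r • e ≠ 0 := smul_ne_zero hr.ne' (norm_ne_zero_iff.1 (by simp [he]))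
      have h : 2 * F 0 < F (r • e) + F (-(r • e)) :=
        two_mul_integral_norm_mul_lt hw hw0 hi hi' he0
      rw [hneg] at h
      exact div_pos (by linarith) hr
    · refine (hd.hasDerivAt.const_mul _).congr_of_eventuallyEq ?_
      filter_upwards [lt_mem_nhds hr] with t ht
      have h := hU (t • e)
      rw [norm_smul, he, mul_one, Real.norm_of_nonneg ht.le, huF] at h
      exact h.symm
  have hmain (r : ℝ) (hr : 0 < r) : DifferentiableAt ℝ U r ∧ deriv U r < 0 := by
    obtain ⟨d, hd, h⟩ := hderiv r hr
    refine ⟨h.differentiableAt, ?_⟩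
    rw [h.deriv]
    exact mul_neg_of_neg_of_pos (neg_neg_of_pos hk) hd
  refine ⟨hmain, strictAntiOn_of_deriv_neg (convex_Ioi 0)
    (fun r hr => (hmain r hr).1.continuousAt.continuousWithinAt) fun r hr => ?_⟩
  rw [interior_Ioi] at hr
  exact (hmain r hr).2
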